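/- In modal system T, let X and X' be modal formulas and Y and Y' propositional formulas. If X ≡_{□Y} X' and Y ≡ Y', then Θ(X',□Y') = Θ(X,□Y). -/

import Mathlib

inductive MF : Type
  | var : ℕ → MF
  | neg : MF → MF
  | and : MF → MF → MF
  | or  : MF → MF → MF
  | box : MF → MF
  | dia : MF → MF

structure Kripke where
  W : Type
  ne : Nonempty W
  R : W → W → Prop
  v : W → ℕ → Prop

/-- A Kripke model of system T: the accessibility relation is reflexive. -/
def IsT (M : Kripke) : Prop := ∀ w, M.R w w

/-- Truth of a modal formula at a world of a Kripke model. -/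
def MF.sat (M : Kripke) : MF → M.W → Prop
  | var n, w => M.v w n
  | neg φ, w => ¬ MF.sat M φ w
  | and φ ψ, w => MF.sat M φ w ∧ MF.sat M ψ w
  | or φ ψ, w => MF.sat M φ w ∨ MF.sat M ψ w
  | box φ, w => ∀ w', M.R w w' → MF.sat M φ w'
  | dia φ, w => ∃ w', M.R w w' ∧ MF.sat M φ w'

/-- φ is true at every world of M. -/
def globalTrue (M : Kripke) (φ : MF) : Prop := ∀ w, MF.sat M φ w

/-- Global entailment in system T (over reflexive Kripke models). -/
def entailsT (φ ψ : MF) : Prop :=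
  ∀ M : Kripke, IsT M → globalTrue M φ → globalTrue M ψ

/-- Global equivalence in system T. -/
def equivT (φ ψ : MF) : Prop := entailsT φ ψ ∧ entailsT ψ φ

/-- A formula is propositional if it contains no modal operators. -/
def Propositional : MF → Prop
  | .var _ => True
  | .neg φ => Propositional φ
  | .and φ ψ => Propositional φ ∧ Propositional ψ
  | .or φ ψ => Propositional φ ∧ Propositional ψ
  | .box _ => False
  | .dia _ => False

/-- X₁ ⊨_Y X₂ iff X₁ ∧ Y ⊨ X₂ (system T). -/
def entailsWT (Y X₁ X₂ : MF) : Prop := entailsT (X₁.and Y) X₂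

/-- X₁ ≡_Y X₂ (system T). -/
def equivWT (Y X₁ X₂ : MF) : Prop := entailsWT Y X₁ X₂ ∧ entailsWT Y X₂ X₁

inductive IsLiteral : MF → Prop
  | var (n : ℕ) : IsLiteral (.var n)
  | nvar (n : ℕ) : IsLiteral (.neg (.var n))
  | box (φ : MF) : IsLiteral (.box φ)
  | dia (φ : MF) : IsLiteral (.dia φ)

inductive IsClause : MF → Prop
  | lit {φ : MF} : IsLiteral φ → IsClause φ
  | or {φ ψ : MF} : IsClause φ → IsClause ψ → IsClause (.or φ ψ)

/-- C is an implicate of X (system T). -/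
def ImplicateT (X C : MF) : Prop := IsClause C ∧ entailsT X C

/-- C is a prime implicate of X (system T). -/
def PrimeImplicateT (X C : MF) : Prop :=
  ImplicateT X C ∧ ∀ C', ImplicateT X C' → entailsT C' C → equivT C' C

/-- Π(X) : the set of prime implicates of X (system T). -/
def PiT (X : MF) : Set MF := {C | PrimeImplicateT X C}

/-- C is a theory implicate of X with respect to Y (system T). -/
def TheoryImplicateT (Y X C : MF) : Prop := IsClause C ∧ entailsWT Y X C

/-- C is a theory prime implicate of X with respect to Y (system T). -/
def TheoryPrimeImplicateT (Y X C : MF) : Prop :=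
  TheoryImplicateT Y X C ∧ ∀ C', TheoryImplicateT Y X C' → entailsWT Y C' C → equivWT Y C' C

/-- Θ(X,Y) : the set of theory prime implicates of X with respect to Y (system T). -/
def ThetaT (X Y : MF) : Set MF := {C | TheoryPrimeImplicateT Y X C}

/-- Global entailment between sets of formulas (identified with the
conjunction of their elements), in system T. -/
def entailsSetT (S T : Set MF) : Prop :=
  ∀ M : Kripke, IsT M → (∀ φ ∈ S, globalTrue M φ) → ∀ φ ∈ T, globalTrue M φ

/-- Over reflexive frames, `□φ` is globally true exactly when `φ` is. -/
theorem globalTrue_box_iff {M : Kripke} (hM : IsT M) (φ : MF) :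
    globalTrue M (.box φ) ↔ globalTrue M φ :=
  ⟨fun h w => h w w (hM w), fun h _ w' _ => h w'⟩

theorem globalTrue_and_iff (M : Kripke) (φ ψ : MF) :
    globalTrue M (.and φ ψ) ↔ globalTrue M φ ∧ globalTrue M ψ :=
  forall_and

theorem entailsWT_iff (Y A B : MF) :
    entailsWT Y A B ↔ ∀ M, IsT M → globalTrue M Y → globalTrue M A → globalTrue M B := by
  simp only [entailsWT, entailsT, globalTrue_and_iff]
  grind

theorem entailsWT_trans {Y A B C : MF} (hAB : entailsWT Y A B) (hBC : entailsWT Y B C) :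
    entailsWT Y A C := by
  rw [entailsWT_iff] at *
  exact fun M hM hY hA => hBC M hM hY (hAB M hM hY hA)

theorem equivT_box {Y Y' : MF} (h : equivT Y Y') : equivT (.box Y) (.box Y') :=
  ⟨fun M hM hY => (globalTrue_box_iff hM Y').2 (h.1 M hM ((globalTrue_box_iff hM Y).1 hY)),
    fun M hM hY => (globalTrue_box_iff hM Y).2 (h.2 M hM ((globalTrue_box_iff hM Y').1 hY))⟩

theorem entailsWT_congr_theory {Y Y' : MF} (h : equivT Y Y') : entailsWT Y = entailsWT Y' := by
  ext A B
  rw [entailsWT_iff, entailsWT_iff]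
  exact ⟨fun H M hM hY => H M hM (h.2 M hM hY), fun H M hM hY => H M hM (h.1 M hM hY)⟩

theorem theoryImplicateT_congr {Y X X' : MF} (h : equivWT Y X X') :
    TheoryImplicateT Y X = TheoryImplicateT Y X' := by
  ext C
  exact and_congr_right fun _ => ⟨entailsWT_trans h.2, entailsWT_trans h.1⟩

theorem thetaT_congr_formula {Y X X' : MF} (h : equivWT Y X X') : ThetaT X Y = ThetaT X' Y := by
  simp only [ThetaT, TheoryPrimeImplicateT, theoryImplicateT_congr h]

theorem thetaT_congr_theory (X : MF) {Y Y' : MF} (h : equivT Y Y') :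
    ThetaT X Y = ThetaT X Y' := by
  simp only [ThetaT, TheoryPrimeImplicateT, TheoryImplicateT, equivWT, entailsWT_congr_theory h]

/-- in system T, if X ≡_{□Y} X' and Y ≡ Y' then
Θ(X',□Y') = Θ(X,□Y). -/
theorem equivalence_of_tpi (X X' Y Y' : MF)
    (hY : Propositional Y) (hY' : Propositional Y')
    (h1 : equivWT (MF.box Y) X X') (h2 : equivT Y Y') :
    ThetaT X' (MF.box Y') = ThetaT X (MF.box Y) := by
  rw [thetaT_congr_formula h1, thetaT_congr_theory X' (equivT_box h2)]
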